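/- Let G be a finite simple graph and let r_1, …, r_k be natural numbers such that r_1 + r_2 + … + r_k ≥ Δ(G) + 2 − k, where Δ(G) denotes the maximum degree of G. Then the vertex set V(G) can be partitioned into sets V_1, …, V_k such that for each i ∈ {1, …, k}, the maximum degree of the induced subgraph G[V_i] is at most r_i and G[V_i] contains no connected component that is r_i-regular and not a complete graph. -/

import Mathlib

open scoped Classical

namespace PNRC

variable {V : Type*} [Fintype V] (G : SimpleGraph V) {k : ℕ} (r : Fin k → ℕ)

/-- number of neighbours of `v` in colour `i` -/
noncomputable def dg (φ : V → Fin k) (i : Fin k) (v : V) : ℕ :=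
  (Finset.univ.filter (fun u => G.Adj v u ∧ φ u = i)).card

/-- potential -/
noncomputable def pot (φ : V → Fin k) : ℤ :=
  (∑ v, ∑ u, (if G.Adj v u ∧ φ v = φ u then (1 : ℤ) else 0)) - 2 * ∑ v, (r (φ v) : ℤ)

lemma sum_split (g : V → V → ℤ) (hs : ∀ a b, g a b = g b a) (x : V) (hx : g x x = 0) :
    ∑ v, ∑ u, g v u = ∑ v ∈ Finset.univ.erase x, ∑ u ∈ Finset.univ.erase x, g v u
      + 2 * ∑ u, g x u := by
  have h1 : ∀ v, ∑ u, g v u = ∑ u ∈ Finset.univ.erase x, g v u + g v x := by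
    intro v
    exact (Finset.sum_erase_add _ _ (Finset.mem_univ x)).symm
  rw [← Finset.sum_erase_add _ _ (Finset.mem_univ x)]
  have h2 : ∑ v ∈ Finset.univ.erase x, ∑ u, g v u
      = ∑ v ∈ Finset.univ.erase x, ∑ u ∈ Finset.univ.erase x, g v u
        + ∑ v ∈ Finset.univ.erase x, g v x := by
    rw [← Finset.sum_add_distrib]
    exact Finset.sum_congr rfl (fun v _ => h1 v)
  have h3 : ∑ v ∈ Finset.univ.erase x, g v x = ∑ u, g x u := by
    rw [h1 x, hx, add_zero]
    exact Finset.sum_congr rfl (fun v _ => hs v x)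
  rw [h2, h3]; ring

lemma sum_dg (φ : V → Fin k) (i : Fin k) (x : V) :
    ∑ u, (if G.Adj x u ∧ i = φ u then (1 : ℤ) else 0) = dg G φ i x := by
  unfold dg
  rw [Finset.sum_boole]
  simp only [eq_comm]

lemma dg_update_self (φ : V → Fin k) (x : V) (j l : Fin k) :
    dg G (Function.update φ x j) l x = dg G φ l x := by
  unfold dg
  congr 1
  apply Finset.filter_congr
  intro u _
  by_cases h : u = x
  · subst h; simp
  · rw [Function.update_of_ne h]

lemma dg_update_of_not_adj (φ : V → Fin k) (x v : V) (j l : Fin k) (h : ¬ G.Adj v x) :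
    dg G (Function.update φ x j) l v = dg G φ l v := by
  unfold dg
  congr 1
  apply Finset.filter_congr
  intro u _
  by_cases h' : u = x
  · subst h'; simp [h]
  · rw [Function.update_of_ne h']

lemma dg_update_of_ne (φ : V → Fin k) (x v : V) (j l : Fin k) (h1 : φ x ≠ l) (h2 : j ≠ l) :
    dg G (Function.update φ x j) l v = dg G φ l v := by
  unfold dg
  congr 1
  apply Finset.filter_congr
  intro u _
  by_cases h' : u = x
  · subst h'; simp [h1, h2]
  · rw [Function.update_of_ne h']

lemma dg_update_add (φ : V → Fin k) (x v : V) (j : Fin k) (h : G.Adj v x) (h1 : φ x ≠ j) :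
    dg G (Function.update φ x j) j v = dg G φ j v + 1 := by
  unfold dg
  rw [← Finset.card_insert_of_notMem (a := x)]
  · congr 1
    ext u
    by_cases h' : u = x
    · subst h'; simp [h]
    · simp [h']
  · simp [h1]

lemma dg_update_sub (φ : V → Fin k) (x v : V) (j : Fin k) (h : G.Adj v x) (h1 : φ x ≠ j) :
    dg G (Function.update φ x j) (φ x) v + 1 = dg G φ (φ x) v := by
  unfold dg
  rw [← Finset.card_insert_of_notMem (a := x)]
  · congr 1
    ext u
    by_cases h' : u = x
    · subst h'; simp [h]
    · simp [h']
  · simp [h1.symm]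

lemma pot_update (φ : V → Fin k) (x : V) (j : Fin k) :
    pot G r (Function.update φ x j) = pot G r φ + 2 * ((dg G φ j x : ℤ) - r j)
      - 2 * ((dg G φ (φ x) x : ℤ) - r (φ x)) := by
  unfold pot
  have hsym : ∀ (ψ : V → Fin k) (a b : V),
      (if G.Adj a b ∧ ψ a = ψ b then (1 : ℤ) else 0)
        = (if G.Adj b a ∧ ψ b = ψ a then (1 : ℤ) else 0) := by
    intro ψ a b
    congr 1
    rw [G.adj_comm, eq_comm (a := ψ a)]
  rw [sum_split _ (hsym (Function.update φ x j)) x (by simp), sum_split _ (hsym φ) x (by simp)]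
  rw [← Finset.sum_erase_add (s := Finset.univ) (a := x) (h := Finset.mem_univ x)
    (f := fun v => (r (Function.update φ x j v) : ℤ))]
  rw [← Finset.sum_erase_add (s := Finset.univ) (a := x) (h := Finset.mem_univ x)
    (f := fun v => (r (φ v) : ℤ))]
  rw [sum_dg, sum_dg, dg_update_self]
  have h1 : ∑ v ∈ Finset.univ.erase x, ∑ u ∈ Finset.univ.erase x,
      (if G.Adj v u ∧ Function.update φ x j v = Function.update φ x j u then (1 : ℤ) else 0)
      = ∑ v ∈ Finset.univ.erase x, ∑ u ∈ Finset.univ.erase x,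
      (if G.Adj v u ∧ φ v = φ u then (1 : ℤ) else 0) := by
    apply Finset.sum_congr rfl
    intro v hv
    apply Finset.sum_congr rfl
    intro u hu
    rw [Function.update_of_ne (Finset.ne_of_mem_erase hv),
      Function.update_of_ne (Finset.ne_of_mem_erase hu)]
  have h2 : ∑ v ∈ Finset.univ.erase x, (r (Function.update φ x j v) : ℤ)
      = ∑ v ∈ Finset.univ.erase x, (r (φ v) : ℤ) := by
    apply Finset.sum_congr rfl
    intro v hv
    rw [Function.update_of_ne (Finset.ne_of_mem_erase hv)]
  rw [h1, h2, Function.update_self]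
  ring

lemma exists_target (hd : ∀ v, G.degree v + 2 ≤ ∑ i, r i + k) (φ : V → Fin k) (x : V)
    (i : Fin k) (h : r i ≤ dg G φ i x) : ∃ l, l ≠ i ∧ dg G φ l x ≤ r l := by
  by_contra hcon
  push Not at hcon
  have h1 : G.degree x = ∑ l, dg G φ l x := by
    unfold dg
    rw [← G.card_neighborFinset_eq_degree, Finset.card_eq_sum_card_fiberwise (f := φ)
      (t := Finset.univ) (by intro a _; simp)]
    apply Finset.sum_congr rfl
    intro l _
    congr 1
    ext u
    simp
  have h2 : ∑ l, (r l + 1) ≤ ∑ l, (dg G φ l x + if l = i then 1 else 0) := by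
    apply Finset.sum_le_sum
    intro l _
    by_cases hl : l = i
    · subst hl; simpa using h
    · simpa [hl] using hcon l hl
  rw [Finset.sum_add_distrib, Finset.sum_add_distrib, ← h1] at h2
  simp at h2
  have := hd x
  omega

/-- minimality of the potential -/
def FMin (φ : V → Fin k) : Prop := ∀ ψ : V → Fin k, pot G r φ ≤ pot G r ψ

lemma drop_many (hd : ∀ v, G.degree v + 2 ≤ ∑ i, r i + k) (j : Fin k) (I : Finset V) :
    ∀ ψ : V → Fin k, (∀ e ∈ I, ψ e = j ∧ r j + 1 ≤ dg G ψ j e) →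
      (∀ a ∈ I, ∀ b ∈ I, ¬ G.Adj a b) →
      ∃ ψ' : V → Fin k, pot G r ψ' + 2 * (I.card : ℤ) ≤ pot G r ψ := by
  induction I using Finset.induction_on with
  | empty => intro ψ _ _; exact ⟨ψ, by simp⟩
  | insert e I he ih =>
    intro ψ h1 h2
    obtain ⟨hc, hdeg⟩ := h1 e (Finset.mem_insert_self _ _)
    obtain ⟨l, hl, hle⟩ := exists_target G r hd ψ e j (by omega)
    obtain ⟨ψ', hψ'⟩ := ih (Function.update ψ e l) (by
        intro a ha
        have hae : a ≠ e := fun h => he (h ▸ ha)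
        obtain ⟨q1, q2⟩ := h1 a (Finset.mem_insert_of_mem ha)
        refine ⟨by rw [Function.update_of_ne hae]; exact q1, ?_⟩
        rw [dg_update_of_not_adj _ _ _ _ _ _
          (h2 a (Finset.mem_insert_of_mem ha) e (Finset.mem_insert_self _ _))]
        exact q2)
      (fun a ha b hb => h2 a (Finset.mem_insert_of_mem ha) b (Finset.mem_insert_of_mem hb))
    refine ⟨ψ', ?_⟩
    have := pot_update G r ψ e l
    rw [hc] at this
    rw [Finset.card_insert_of_notMem he]
    push_cast
    omega

lemma dg_le (hd : ∀ v, G.degree v + 2 ≤ ∑ i, r i + k) {φ : V → Fin k} (hφ : FMin G r φ)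
    (v : V) : dg G φ (φ v) v ≤ r (φ v) := by
  by_contra hcon
  obtain ⟨ψ', h⟩ := drop_many G r hd (φ v) {v} φ (by
    intro e he
    rw [Finset.mem_singleton] at he
    subst he
    exact ⟨rfl, by omega⟩) (by simp)
  have := hφ ψ'
  simp at h
  omega

lemma indep_bound (hd : ∀ v, G.degree v + 2 ≤ ∑ i, r i + k) {φ : V → Fin k} (hφ : FMin G r φ)
    (x : V) (j : Fin k) (hxj : φ x ≠ j) (hx : dg G φ (φ x) x = r (φ x)) (I : Finset V)
    (hI : ∀ e ∈ I, G.Adj e x ∧ φ e = j ∧ dg G φ j e = r j)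
    (hind : ∀ a ∈ I, ∀ b ∈ I, ¬ G.Adj a b) : I.card + r j ≤ dg G φ j x := by
  obtain ⟨ψ', h⟩ := drop_many G r hd j I (Function.update φ x j) (by
    intro e he
    obtain ⟨h1, h2, h3⟩ := hI e he
    refine ⟨by rw [Function.update_of_ne h1.ne]; exact h2, ?_⟩
    rw [dg_update_add _ _ _ _ _ h1 hxj]
    omega) hind
  have h1 := pot_update G r φ x j
  have := hφ ψ'
  rw [hx] at h1
  omega

lemma exists_move (hd : ∀ v, G.degree v + 2 ≤ ∑ i, r i + k) {φ : V → Fin k} (hφ : FMin G r φ)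
    (x : V) (hx : dg G φ (φ x) x = r (φ x)) :
    ∃ j, j ≠ φ x ∧ dg G φ j x = r j ∧ FMin G r (Function.update φ x j) := by
  obtain ⟨j, hj, hle⟩ := exists_target G r hd φ x (φ x) (by omega)
  have h1 := pot_update G r φ x j
  have h2 := hφ (Function.update φ x j)
  have h3 : dg G φ j x = r j := by omega
  refine ⟨j, hj, h3, ?_⟩
  intro ψ
  have := hφ ψ
  omega

/-- connectedness of a set by cuts -/
def PConn (S : Finset V) : Prop :=
  ∀ T ⊆ S, T.Nonempty → (∀ a ∈ T, ∀ b ∈ S, G.Adj a b → b ∈ T) → T = S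

variable {G} in
lemma PConn.ins {K : Finset V} (hK : PConn G K) {a b : V} (ha : a ∈ K) (hab : G.Adj a b) :
    PConn G (insert b K) := by
  intro T hT hne hcl
  have key : (T ∩ K).Nonempty → T = insert b K := by
    intro h
    have h1 : T ∩ K = K := hK _ Finset.inter_subset_right h (by
      intro c hc d hd' hcd
      rw [Finset.mem_inter] at hc ⊢
      exact ⟨hcl c hc.1 d (Finset.mem_insert_of_mem hd') hcd, hd'⟩)
    have h2 : K ⊆ T := by rw [← h1]; exact Finset.inter_subset_left
    apply Finset.Subset.antisymm hT
    apply Finset.insert_subset _ h2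
    exact hcl a (h2 ha) b (Finset.mem_insert_self _ _) hab
  apply key
  obtain ⟨c, hc⟩ := hne
  rcases Finset.mem_insert.1 (hT hc) with h | h
  · subst h
    exact ⟨a, Finset.mem_inter.2 ⟨hcl c hc a (Finset.mem_insert_of_mem ha) hab.symm, ha⟩⟩
  · exact ⟨c, Finset.mem_inter.2 ⟨hc, h⟩⟩

lemma PConn.singleton (u : V) : PConn G {u} := by
  intro T hT hne _
  exact (Finset.Nonempty.subset_singleton_iff hne).1 hT

variable {G} in
lemma exists_noncut {A : Finset V} (hA : PConn G A) (u : V) (hu : u ∈ A)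
    (hw : ∃ w ∈ A, w ≠ u ∧ ¬ G.Adj u w) :
    ∃ x ∈ A, x ≠ u ∧ ¬ G.Adj u x ∧ PConn G (A.erase x) := by
  obtain ⟨w0, hw0, hne0, hna0⟩ := hw
  let Pr : V × Finset V → Prop := fun p =>
    p.1 ∈ A ∧ p.1 ≠ u ∧ ¬ G.Adj u p.1 ∧ p.2 ⊆ A.erase p.1 ∧ u ∈ p.2 ∧ PConn G p.2
  obtain ⟨⟨w, K⟩, hp, hmax⟩ := Finset.exists_max_image
    ((Finset.univ : Finset (V × Finset V)).filter Pr) (fun p => p.2.card)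
    ⟨(w0, {u}), by
      simp only [Finset.mem_filter, Finset.mem_univ, true_and]
      exact ⟨hw0, hne0, hna0, by simp [hu, hne0.symm], by simp, PConn.singleton G u⟩⟩
  simp only [Finset.mem_filter, Finset.mem_univ, true_and] at hp hmax
  obtain ⟨h1, h2, h3, h4, h5, h6⟩ := hp
  dsimp only at h1 h2 h3 h4 h5 h6
  have hcl : ∀ a ∈ K, ∀ b ∈ A.erase w, G.Adj a b → b ∈ K := by
    intro a ha b hb hab
    by_contra hbK
    have := hmax (w, insert b K) ⟨h1, h2, h3, Finset.insert_subset hb h4,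
      Finset.mem_insert_of_mem h5, h6.ins ha hab⟩
    simp only [Finset.card_insert_of_notMem hbK] at this
    omega
  have hEq : K = A.erase w := by
    by_contra hKA
    obtain ⟨w', hw', hw'K⟩ : ∃ w' ∈ A.erase w, w' ∉ K := by
      by_contra hcon
      push Not at hcon
      exact hKA (Finset.Subset.antisymm h4 hcon)
    have hwK : w ∉ K := fun h => (Finset.mem_erase.1 (h4 h)).1 rfl
    have hadj : ∃ a ∈ K, G.Adj a w := by
      by_contra hcon
      push Not at hcon
      have : K = A := hA K (h4.trans (Finset.erase_subset _ _)) ⟨u, h5⟩ (by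
        intro a ha b hb hab
        apply hcl a ha b _ hab
        rw [Finset.mem_erase]
        refine ⟨?_, hb⟩
        rintro rfl
        exact hcon a ha hab)
      exact hwK (this ▸ h1)
    obtain ⟨a, ha, haw⟩ := hadj
    have hw'A := Finset.mem_erase.1 hw'
    have := hmax (w', insert w K) ⟨hw'A.2, fun h => hw'K ((show w' = u from h) ▸ h5),
      fun h => hw'K (hcl u h5 w' hw' h), by
        apply Finset.insert_subset
        · exact Finset.mem_erase.2 ⟨hw'A.1.symm, h1⟩
        · intro b hb
          refine Finset.mem_erase.2 ⟨fun h => hw'K ((show b = w' from h) ▸ hb), (Finset.mem_erase.1 (h4 hb)).2⟩,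
      Finset.mem_insert_of_mem h5, h6.ins ha haw⟩
    simp only [Finset.card_insert_of_notMem hwK] at this
    omega
  exact ⟨w, h1, h2, h3, hEq ▸ h6⟩

/-- `S` is a component of colour class `i` -/
def Comp (φ : V → Fin k) (i : Fin k) (S : Finset V) : Prop :=
  S.Nonempty ∧ (∀ v ∈ S, φ v = i) ∧ PConn G S ∧ ∀ a ∈ S, ∀ b, G.Adj a b → φ b = i → b ∈ S

/-- `S` is an obstruction of colour `i` -/
def Obs (φ : V → Fin k) (i : Fin k) (S : Finset V) : Prop :=
  Comp G φ i S ∧ (∀ v ∈ S, dg G φ i v = r i) ∧ ∃ u ∈ S, ∃ w ∈ S, u ≠ w ∧ ¬ G.Adj u w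

lemma exists_comp (φ : V → Fin k) (x : V) : ∃ S, x ∈ S ∧ Comp G φ (φ x) S := by
  let Pr : Finset V → Prop := fun S => x ∈ S ∧ (∀ v ∈ S, φ v = φ x) ∧ PConn G S
  obtain ⟨S, hp, hmax⟩ := Finset.exists_max_image
    ((Finset.univ : Finset (Finset V)).filter Pr) (fun p => p.card)
    ⟨{x}, by
      simp only [Finset.mem_filter, Finset.mem_univ, true_and]
      exact ⟨by simp, by simp, PConn.singleton G x⟩⟩
  simp only [Finset.mem_filter, Finset.mem_univ, true_and] at hp hmax
  obtain ⟨h1, h2, h3⟩ := hp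
  refine ⟨S, h1, ⟨x, h1⟩, h2, h3, ?_⟩
  intro a ha b hab hb
  by_contra hbS
  have := hmax (insert b S) ⟨Finset.mem_insert_of_mem h1, by
    intro v hv
    rcases Finset.mem_insert.1 hv with h | h
    · rw [h]; exact hb
    · exact h2 v h, h3.ins ha hab⟩
  rw [Finset.card_insert_of_notMem hbS] at this
  omega

variable {G} in
/-- a connected monochromatic set meeting a component is contained in it -/
lemma Comp.subset_of {φ : V → Fin k} {i : Fin k} {S B : Finset V} (hS : Comp G φ i S)
    (hB : PConn G B) (hc : ∀ v ∈ B, φ v = i) {a : V} (ha : a ∈ S) (ha' : a ∈ B) : B ⊆ S := by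
  have : B ∩ S = B := hB _ Finset.inter_subset_left ⟨a, Finset.mem_inter.2 ⟨ha', ha⟩⟩ (by
    intro c hc' d hd' hcd
    rw [Finset.mem_inter] at hc' ⊢
    exact ⟨hd', hS.2.2.2 c hc'.2 d hcd (hc d hd')⟩)
  rw [← this]
  exact Finset.inter_subset_right

variable {G} in
lemma Comp.unique {φ : V → Fin k} {i : Fin k} {S T : Finset V} (hS : Comp G φ i S)
    (hT : Comp G φ i T) {a : V} (ha : a ∈ S) (ha' : a ∈ T) : S = T :=
  Finset.Subset.antisymm (hT.subset_of hS.2.2.1 hS.2.1 ha' ha)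
    (hS.subset_of hT.2.2.1 hT.2.1 ha ha')

/-- number of obstructions -/
noncomputable def nobs (φ : V → Fin k) : ℕ :=
  ((Finset.univ : Finset (Fin k × Finset V)).filter (fun p => Obs G r φ p.1 p.2)).card

/-- minimal colourings -/
def CMin (φ : V → Fin k) : Prop :=
  FMin G r φ ∧ ∀ ψ : V → Fin k, FMin G r ψ → nobs G r φ ≤ nobs G r ψ

lemma exists_CMin [Nonempty (V → Fin k)] : ∃ φ : V → Fin k, CMin G r φ := by
  obtain ⟨φ, _, h⟩ := Finset.exists_min_image (Finset.univ : Finset (V → Fin k))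
    (pot G r) Finset.univ_nonempty
  have hF : FMin G r φ := fun ψ => h ψ (Finset.mem_univ _)
  obtain ⟨φ', h1, h2⟩ := Finset.exists_min_image
    ((Finset.univ : Finset (V → Fin k)).filter (FMin G r)) (nobs G r) ⟨φ, by simpa using hF⟩
  refine ⟨φ', by simpa using h1, fun ψ hψ => h2 ψ (by simpa using hψ)⟩

lemma obs_update {φ : V → Fin k} {i j : Fin k} {A S A' : Finset V} {x : V} {l : Fin k}
    (hA : Obs G r φ i A) (hx : x ∈ A) (hij : j ≠ i)
    (hxA' : x ∈ A') (hA' : Comp G (Function.update φ x j) j A')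
    (hS : Obs G r (Function.update φ x j) l S) :
    (l = j ∧ S = A') ∨ (Obs G r φ l S ∧ x ∉ S) := by
  have hxi : φ x = i := hA.1.2.1 x hx
  obtain ⟨hC, hreg, hnc⟩ := hS
  by_cases hxS : x ∈ S
  · left
    have hl : l = j := by
      have := hC.2.1 x hxS
      rw [Function.update_self] at this
      exact this.symm
    subst hl
    exact ⟨rfl, hC.unique hA' hxS hxA'⟩
  · right
    refine ⟨?_, hxS⟩
    have hcol : ∀ v ∈ S, φ v = l := by
      intro v hv
      have hvx : v ≠ x := fun h => hxS (h ▸ hv)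
      have := hC.2.1 v hv
      rwa [Function.update_of_ne hvx] at this
    have hnadj : φ x = l → ∀ v ∈ S, ¬ G.Adj v x := by
      intro hxl v hv hadj
      have hil : i = l := hxi.symm.trans hxl
      subst hil
      have hvA : v ∈ A := hA.1.2.2.2 x hx v hadj.symm (hcol v hv)
      have e1 := hA.2.1 v hvA
      have e2 := hreg v hv
      have e3 := dg_update_sub G φ x v j hadj (by rw [hxi]; exact hij.symm)
      rw [hxi] at e3
      omega
    have hnadj' : j = l → ∀ v ∈ S, ¬ G.Adj v x := by
      intro hjl v hv hadj
      exact hxS (hC.2.2.2 v hv x hadj (by rw [Function.update_self]; exact hjl))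
    refine ⟨⟨hC.1, hcol, hC.2.2.1, ?_⟩, ?_, hnc⟩
    · intro a ha b hab hb
      by_cases hbx : b = x
      · subst hbx
        exact absurd hab (hnadj hb a ha)
      · exact hC.2.2.2 a ha b hab (by rw [Function.update_of_ne hbx]; exact hb)
    · intro v hv
      rw [← hreg v hv]
      symm
      by_cases h1 : φ x = l
      · exact dg_update_of_not_adj _ _ _ _ _ _ (hnadj h1 v hv)
      · by_cases h2 : j = l
        · exact dg_update_of_not_adj _ _ _ _ _ _ (hnadj' h2 v hv)
        · exact dg_update_of_ne _ _ _ _ _ _ h1 h2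

lemma step (hd : ∀ v, G.degree v + 2 ≤ ∑ i, r i + k) {φ : V → Fin k} (hφ : CMin G r φ)
    {i : Fin k} {A : Finset V} (hA : Obs G r φ i A) {x : V} (hx : x ∈ A) :
    ∃ j, j ≠ i ∧ CMin G r (Function.update φ x j) ∧
      ∃ A', x ∈ A' ∧ Obs G r (Function.update φ x j) j A' := by
  have hxi : φ x = i := hA.1.2.1 x hx
  obtain ⟨j, hj, hdj, hF⟩ := exists_move G r hd hφ.1 x (by rw [hxi]; exact hA.2.1 x hx)
  rw [hxi] at hj
  obtain ⟨A', hxA', hA'⟩ := exists_comp G (Function.update φ x j) x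
  rw [Function.update_self] at hA'
  have hsub : ∀ p : Fin k × Finset V, Obs G r (Function.update φ x j) p.1 p.2 →
      p = (j, A') ∨ (Obs G r φ p.1 p.2 ∧ p ≠ (i, A)) := by
    rintro ⟨l, S⟩ hS
    rcases obs_update G r hA hx hj hxA' hA' hS with ⟨h1, h2⟩ | ⟨h1, h2⟩
    · left; dsimp only at h1 h2; rw [h1, h2]
    · right
      refine ⟨h1, ?_⟩
      intro h
      rw [Prod.mk.injEq] at h
      exact h2 (h.2 ▸ hx)
  set O := (Finset.univ : Finset (Fin k × Finset V)).filter (fun p => Obs G r φ p.1 p.2) with hO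
  have hmem : (i, A) ∈ O := by simp [hO, hA]
  have hcard : (O.erase (i, A)).card + 1 = nobs G r φ := Finset.card_erase_add_one hmem
  have hobs : Obs G r (Function.update φ x j) j A' := by
    by_contra hno
    have h1 : nobs G r (Function.update φ x j) ≤ (O.erase (i, A)).card := by
      apply Finset.card_le_card
      intro p hp
      rw [Finset.mem_filter] at hp
      rcases hsub p hp.2 with h | h
      · subst h; exact absurd hp.2 hno
      · rw [Finset.mem_erase]
        exact ⟨h.2, by simp [hO, h.1]⟩
    have := hφ.2 _ hF
    omega
  refine ⟨j, hj, ⟨hF, ?_⟩, A', hxA', hobs⟩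
  intro ψ hψ
  have h1 : nobs G r (Function.update φ x j) ≤ (insert (j, A') (O.erase (i, A))).card := by
    apply Finset.card_le_card
    intro p hp
    rw [Finset.mem_filter] at hp
    rw [Finset.mem_insert]
    rcases hsub p hp.2 with h | h
    · left; exact h
    · right
      rw [Finset.mem_erase]
      exact ⟨h.2, by simp [hO, h.1]⟩
  have h2 := Finset.card_insert_le (j, A') (O.erase (i, A))
  have := hφ.2 _ hψ
  omega

/-- in an obstruction every vertex has a non-neighbour -/
lemma obs_nonnbr {φ : V → Fin k} {i : Fin k} {A : Finset V} (hA : Obs G r φ i A) {u : V}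
    (hu : u ∈ A) : ∃ w ∈ A, w ≠ u ∧ ¬ G.Adj u w := by
  by_contra hcon
  push Not at hcon
  obtain ⟨hC, hreg, a, ha, b, hb, hab, hnab⟩ := hA
  have hsub : ∀ v ∈ A, (Finset.univ.filter (fun u => G.Adj v u ∧ φ u = i)) ⊆ A.erase v := by
    intro v hv w hw
    simp only [Finset.mem_filter, Finset.mem_univ, true_and] at hw
    rw [Finset.mem_erase]
    exact ⟨hw.1.ne', hC.2.2.2 v hv w hw.1 hw.2⟩
  have h1 : A.card - 1 ≤ r i := by
    rw [← hreg u hu, ← Finset.card_erase_of_mem hu]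
    apply Finset.card_le_card
    intro w hw
    rw [Finset.mem_erase] at hw
    simp only [Finset.mem_filter, Finset.mem_univ, true_and]
    exact ⟨hcon w hw.2 hw.1, hC.2.1 w hw.2⟩
  have h2 : r i = (Finset.univ.filter (fun u => G.Adj a u ∧ φ u = i)).card := (hreg a ha).symm
  have h3 : (Finset.univ.filter (fun u => G.Adj a u ∧ φ u = i)) = A.erase a := by
    apply Finset.eq_of_subset_of_card_le (hsub a ha)
    rw [Finset.card_erase_of_mem ha, ← h2]
    exact h1
  have : b ∈ Finset.univ.filter (fun u => G.Adj a u ∧ φ u = i) := by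
    rw [h3, Finset.mem_erase]
    exact ⟨hab.symm, hb⟩
  simp only [Finset.mem_filter, Finset.mem_univ, true_and] at this
  exact hnab this.1

/-- neighbourhoods in an obstruction are not cliques -/
lemma obs_nbr {φ : V → Fin k} {i : Fin k} {A : Finset V} (hA : Obs G r φ i A) {u : V}
    (hu : u ∈ A) : ∃ y ∈ A, ∃ z ∈ A, G.Adj u y ∧ G.Adj u z ∧ y ≠ z ∧ ¬ G.Adj y z := by
  by_contra hcon
  push Not at hcon
  obtain ⟨w, hw, hwu, hnw⟩ := obs_nonnbr G r hA hu
  obtain ⟨hC, hreg, -⟩ := hA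
  set N := A.filter (fun v => G.Adj u v) with hN
  have hNdeg : ∀ v ∈ A, dg G φ i v = (A.filter (fun w => G.Adj v w)).card := by
    intro v hv
    unfold dg
    congr 1
    ext w
    simp only [Finset.mem_filter, Finset.mem_univ, true_and]
    exact ⟨fun h => ⟨hC.2.2.2 v hv w h.1 h.2, h.1⟩, fun h => ⟨h.2, hC.2.1 w h.1⟩⟩
  have hNc : N.card = r i := by rw [← hreg u hu, hNdeg u hu]
  have huN : u ∉ N := by simp [hN]
  have hT : insert u N = A := by
    apply hC.2.2.1
    · exact Finset.insert_subset hu (Finset.filter_subset _ _)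
    · exact ⟨u, Finset.mem_insert_self _ _⟩
    · intro a ha b hb hab
      rcases Finset.mem_insert.1 ha with h | h
      · subst h
        exact Finset.mem_insert_of_mem (by simp [hN, hb, hab])
      · have haA : a ∈ A := (Finset.mem_filter.1 h).1
        have hua : G.Adj u a := (Finset.mem_filter.1 h).2
        have hs : (insert u N).erase a ⊆ A.filter (fun w => G.Adj a w) := by
          intro c hc
          rw [Finset.mem_erase] at hc
          rw [Finset.mem_filter]
          rcases Finset.mem_insert.1 hc.2 with h' | h'
          · subst h'; exact ⟨hu, hua.symm⟩
          · have := Finset.mem_filter.1 h'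
            exact ⟨this.1, hcon a haA c this.1 hua this.2 hc.1.symm⟩
        have he : (insert u N).erase a = A.filter (fun w => G.Adj a w) := by
          apply Finset.eq_of_subset_of_card_le hs
          rw [← hNdeg a haA, hreg a haA, Finset.card_erase_of_mem ha,
            Finset.card_insert_of_notMem huN, hNc]
          omega
        have : b ∈ A.filter (fun w => G.Adj a w) := by simp [hb, hab]
        rw [← he] at this
        exact Finset.mem_of_mem_erase this
  rw [← hT] at hw
  rcases Finset.mem_insert.1 hw with h | h
  · exact hwu h
  · exact hnw (Finset.mem_filter.1 h).2

/-- A component `B` of colour `i` left over by a vertex `x`. -/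
structure Ghost (φ : V → Fin k) (u : V) (U : Finset V) (x : V) (i : Fin k) (B : Finset V) :
    Prop where
  card : (B.filter (fun v => G.Adj x v)).card = r i
  pair : ∃ y ∈ B, ∃ z ∈ B, G.Adj x y ∧ G.Adj x z ∧ y ≠ z ∧ ¬ G.Adj y z
  conn : PConn G B
  col : ∀ v ∈ B, φ v = i
  closed : ∀ a ∈ B, ∀ b, G.Adj a b → φ b = i → b ∈ B
  sub : B ⊆ U
  mem : x = u ∨ x ∈ U
  ne : φ x ≠ i
  sat : dg G φ (φ x) x = r (φ x)
  ext : ∀ e, G.Adj x e → φ e = i → e ∉ B → (e = u ∨ e ∈ U) ∧ dg G φ i e = r i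
  ind : ∀ e, G.Adj x e → φ e = i → e ∉ B → ∀ e', G.Adj x e' → φ e' = i → e' ∉ B → ¬ G.Adj e e'

/-- saturated vertices stay saturated -/
lemma sat_stay (hd : ∀ v, G.degree v + 2 ≤ ∑ i, r i + k) {φ : V → Fin k} {i j : Fin k}
    {A U : Finset V} {x u : V} (hA : Obs G r φ i A) (hx : x ∈ A) (hij : j ≠ i)
    (hF : FMin G r (Function.update φ x j)) (hdis : Disjoint A U) (hux : ¬ G.Adj u x)
    {e : V} (hex : e ≠ x) (he : e = u ∨ e ∈ U) (hs : dg G φ (φ e) e = r (φ e)) :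
    dg G (Function.update φ x j) (φ e) e = r (φ e) := by
  have hxi : φ x = i := hA.1.2.1 x hx
  by_cases hadj : G.Adj e x
  · have heU : e ∈ U := by
      rcases he with h | h
      · exact absurd (h ▸ hadj) hux
      · exact h
    have h1 : φ e ≠ i := by
      intro h
      exact Finset.disjoint_left.1 hdis (hA.1.2.2.2 x hx e hadj.symm h) heU
    have h2 : j ≠ φ e := by
      intro h
      have e1 := dg_update_add G φ x e j hadj (by rw [hxi]; exact hij.symm)
      have e2 := dg_le G r hd hF e
      rw [Function.update_of_ne hex] at e2
      rw [h] at e1 e2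
      omega
    rw [dg_update_of_ne _ _ _ _ _ _ (by rw [hxi]; exact h1.symm) h2, hs]
  · rw [dg_update_of_not_adj _ _ _ _ _ _ hadj, hs]

lemma final_contra (hd : ∀ v, G.degree v + 2 ≤ ∑ i, r i + k) {φ : V → Fin k} {i j : Fin k}
    {A A' B U : Finset V} {x u x0 : V} (hA : Obs G r φ i A) (hx : x ∈ A) (hij : j ≠ i)
    (hF : CMin G r (Function.update φ x j)) (hdis : Disjoint A U) (hux : ¬ G.Adj u x)
    (hxu : x ≠ u) (hA' : Obs G r (Function.update φ x j) j A')
    (hg : Ghost G r φ u U x0 j B) (hBA : B ⊆ A') : False := by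
  have hxi : φ x = i := hA.1.2.1 x hx
  have hxU : x ∉ U := Finset.disjoint_left.1 hdis hx
  have hx0x : x0 ≠ x := by
    rintro rfl
    rcases hg.mem with h | h
    · exact hxu h
    · exact hxU h
  set φ' := Function.update φ x j with hφ'
  have hφ'x0 : φ' x0 = φ x0 := Function.update_of_ne hx0x _ _
  have hs0 : dg G φ' (φ x0) x0 = r (φ x0) :=
    sat_stay G r hd hA hx hij hF.1 hdis hux hx0x hg.mem hg.sat
  obtain ⟨y, hy, z, hz, hx0y, hx0z, hyz, hnyz⟩ := hg.pair
  have hyj : φ' y = j := hA'.1.2.1 y (hBA hy)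
  have hzj : φ' z = j := hA'.1.2.1 z (hBA hz)
  obtain ⟨l, hl, hF2, -⟩ := step G r hd hF hA' (hBA hy)
  set φ2 := Function.update φ' y l with hφ2
  have hx0y' : x0 ≠ y := hx0y.ne
  have hφ2x0 : φ2 x0 = φ x0 := by rw [hφ2, Function.update_of_ne hx0y', hφ'x0]
  have hyne : φ' y ≠ l := by rw [hyj]; exact hl.symm
  have hlx0 : l ≠ φ x0 := by
    intro h
    have e1 := dg_update_add G φ' y x0 l hx0y hyne
    have e2 := dg_le G r hd hF2.1 x0
    rw [hφ2x0] at e2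
    rw [← h] at hs0 e2
    try rw [← hφ2] at e1
    omega
  have hs2 : dg G φ2 (φ x0) x0 = r (φ x0) := by
    rw [hφ2, dg_update_of_ne _ _ _ _ _ _ (by rw [hyj]; exact hg.ne.symm) hlx0, hs0]
  have hxB : x ∉ B := fun h => hxU (hg.sub h)
  -- extra neighbours
  set E := Finset.univ.filter (fun e => G.Adj x0 e ∧ φ e = j ∧ e ∉ B) with hE
  have hEx : ∀ e ∈ E, e ≠ x := by
    rintro e he rfl
    simp only [hE, Finset.mem_filter, Finset.mem_univ, true_and] at he
    exact hij (he.2.1.symm.trans hxi)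
  have hzE : z ∉ E := by simp [hE, hz]
  have hEy : ∀ e ∈ E, e ≠ y := by
    rintro e he rfl
    simp only [hE, Finset.mem_filter, Finset.mem_univ, true_and] at he
    exact he.2.2 hy
  have hBE : ∀ b ∈ B, ∀ e ∈ E, ¬ G.Adj b e := by
    intro b hb e he hadj
    simp only [hE, Finset.mem_filter, Finset.mem_univ, true_and] at he
    exact he.2.2 (hg.closed b hb e hadj he.2.1)
  have hbound := indep_bound G r hd hF2.1 x0 j (by rw [hφ2x0]; exact hg.ne)
    (by rw [hφ2x0]; exact hs2) (insert z E) (by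
      intro e he
      rcases Finset.mem_insert.1 he with h | h
      · subst h
        refine ⟨hx0z.symm, ?_, ?_⟩
        · rw [hφ2, Function.update_of_ne hyz.symm, hzj]
        · rw [hφ2, dg_update_of_not_adj _ _ _ _ _ _ (fun h => hnyz h.symm)]
          exact hA'.2.1 e (hBA hz)
      · have hex := hEx e h
        have hey := hEy e h
        have hye : ¬ G.Adj e y := fun h' => hBE y hy e h h'.symm
        simp only [hE, Finset.mem_filter, Finset.mem_univ, true_and] at h
        obtain ⟨h1, h2⟩ := hg.ext e h.1 h.2.1 h.2.2
        refine ⟨h.1.symm, ?_, ?_⟩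
        · rw [hφ2, Function.update_of_ne hey, hφ', Function.update_of_ne hex, h.2.1]
        · rw [hφ2, dg_update_of_not_adj _ _ _ _ _ _ hye]
          have := sat_stay G r hd hA hx hij hF.1 hdis hux hex h1 (by rw [h.2.1]; exact h2)
          rw [h.2.1] at this
          exact this) (by
      intro a ha b hb
      rcases Finset.mem_insert.1 ha with h | h
      · rcases Finset.mem_insert.1 hb with h' | h'
        · subst h; subst h'; exact G.loopless.irrefl _
        · rw [h]; exact hBE z hz b h'
      · rcases Finset.mem_insert.1 hb with h' | h'
        · rw [h']; exact fun hh => hBE z hz a h hh.symm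
        · simp only [hE, Finset.mem_filter, Finset.mem_univ, true_and] at h h'
          exact hg.ind a h.1 h.2.1 h.2.2 b h'.1 h'.2.1 h'.2.2)
  rw [Finset.card_insert_of_notMem hzE] at hbound
  have hup : dg G φ2 j x0 ≤ (insert x (((B.filter (fun v => G.Adj x0 v)).erase y) ∪ E)).card := by
    apply Finset.card_le_card
    intro v hv
    simp only [Finset.mem_filter, Finset.mem_univ, true_and] at hv
    obtain ⟨hv1, hv2⟩ := hv
    have hvy : v ≠ y := by
      rintro rfl
      rw [hφ2, Function.update_self] at hv2
      exact hl hv2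
    rw [hφ2, Function.update_of_ne hvy] at hv2
    by_cases hvx : v = x
    · simp [hvx]
    · rw [hφ', Function.update_of_ne hvx] at hv2
      by_cases hvB : v ∈ B
      · simp [hvx, hvB, hvy, hv1]
      · simp [hvx, hvB, hvy, hv1, hE, hv2]
  have c1 := Finset.card_insert_le x (((B.filter (fun v => G.Adj x0 v)).erase y) ∪ E)
  have c2 := Finset.card_union_le ((B.filter (fun v => G.Adj x0 v)).erase y) E
  have hymem : y ∈ B.filter (fun v => G.Adj x0 v) := by simp [hy, hx0y]
  have c3 := Finset.card_erase_add_one hymem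
  have c4 := hg.card
  omega

lemma walk (hd : ∀ v, G.degree v + 2 ≤ ∑ i, r i + k) (n : ℕ) :
    ∀ (φ : V → Fin k) (i : Fin k) (A U : Finset V) (u : V) (Gh : Set (V × Fin k × Finset V)),
      CMin G r φ → Obs G r φ i A → u ∈ A → Disjoint A U →
      (∀ g ∈ Gh, Ghost G r φ u U g.1 g.2.1 g.2.2) → (∀ v ∈ U, ∃ g ∈ Gh, v ∈ g.2.2) →
      Fintype.card V < U.card + n → False := by
  induction n with
  | zero =>
    intro φ i A U u Gh _ _ _ _ _ _ h
    have := Finset.card_le_univ U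
    omega
  | succ n ih =>
    intro φ i A U u Gh hφ hA hu hdis hGh hU hcard
    obtain ⟨x, hx, hxu, hux, hconn⟩ := exists_noncut hA.1.2.2.1 u hu (obs_nonnbr G r hA hu)
    obtain ⟨j, hij, hF, A', hxA', hA'⟩ := step G r hd hφ hA hx
    have hxi : φ x = i := hA.1.2.1 x hx
    have hxU : x ∉ U := Finset.disjoint_left.1 hdis hx
    have hcolB : ∀ g ∈ Gh, ∀ v ∈ g.2.2, Function.update φ x j v = g.2.1 := by
      intro g hg v hv
      have hvx : v ≠ x := fun h => hxU (h ▸ (hGh g hg).sub hv)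
      rw [Function.update_of_ne hvx]
      exact (hGh g hg).col v hv
    by_cases hdis' : Disjoint A' U
    · -- fresh component
      have hui : φ u = i := hA.1.2.1 u hu
      have huA' : u ∉ A' := by
        intro h
        have := hA'.1.2.1 u h
        rw [Function.update_of_ne hxu.symm, hui] at this
        exact hij this.symm
      have hold : ∀ e, (e = u ∨ e ∈ U) → e ≠ x ∧ e ∉ A' ∧ (e = x ∨ e ∈ U ∪ A.erase x) := by
        rintro e (h | h)
        · subst h
          exact ⟨hxu.symm, huA', Or.inr (by simp [hu, hxu.symm])⟩
        · exact ⟨fun h' => hxU (h' ▸ h), fun h' => Finset.disjoint_left.1 hdis' h' h,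
            Or.inr (by simp [h])⟩
      refine ih (Function.update φ x j) j A' (U ∪ A.erase x) x
        (insert (x, i, A.erase x) Gh) hF hA' hxA' ?_ ?_ ?_ ?_
      · rw [Finset.disjoint_union_right]
        refine ⟨hdis', ?_⟩
        rw [Finset.disjoint_left]
        intro v hv hv'
        rw [Finset.mem_erase] at hv'
        have := hA'.1.2.1 v hv
        rw [Function.update_of_ne hv'.1, hA.1.2.1 v hv'.2] at this
        exact hij this.symm
      · intro g hg
        rcases hg with h | hg
        · subst h
          have hcl : ∀ e, G.Adj x e → Function.update φ x j e = i → e ∈ A.erase x := by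
            intro e h1 h2
            rw [Function.update_of_ne h1.ne'] at h2
            exact Finset.mem_erase.2 ⟨h1.ne', hA.1.2.2.2 x hx e h1 h2⟩
          dsimp only
          refine ⟨?_, ?_, hconn, ?_, ?_, Finset.subset_union_right, Or.inl rfl, ?_, ?_, ?_, ?_⟩
          · rw [← hA.2.1 x hx]
            unfold dg
            congr 1
            ext v
            simp only [Finset.mem_filter, Finset.mem_univ, true_and, Finset.mem_erase]
            constructor
            · rintro ⟨⟨_, h1⟩, h2⟩
              exact ⟨h2, hA.1.2.1 v h1⟩
            · rintro ⟨h1, h2⟩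
              exact ⟨⟨h1.ne', hA.1.2.2.2 x hx v h1 h2⟩, h1⟩
          · obtain ⟨y, hy, z, hz, h1, h2, h3⟩ := obs_nbr G r hA hx
            exact ⟨y, Finset.mem_erase.2 ⟨h1.ne', hy⟩, z, Finset.mem_erase.2 ⟨h2.ne', hz⟩,
              h1, h2, h3⟩
          · intro v hv
            rw [Finset.mem_erase] at hv
            rw [Function.update_of_ne hv.1]
            exact hA.1.2.1 v hv.2
          · intro a ha b hab hb
            rw [Finset.mem_erase] at ha ⊢
            have hbx : b ≠ x := by
              rintro rfl
              rw [Function.update_self] at hb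
              exact hij hb
            rw [Function.update_of_ne hbx] at hb
            exact ⟨hbx, hA.1.2.2.2 a ha.2 b hab hb⟩
          · rw [Function.update_self]; exact hij
          · rw [Function.update_self]; exact hA'.2.1 x hxA'
          · intro e h1 h2 h3
            exact absurd (hcl e h1 h2) h3
          · intro e h1 h2 h3
            exact absurd (hcl e h1 h2) h3
        · obtain ⟨x0, i0, B⟩ := g
          have hg0 := hGh _ hg
          have hcol := hcolB _ hg
          dsimp only at hg0 hcol ⊢
          obtain ⟨q1, q2, q3⟩ := hold x0 hg0.mem
          have hB' : ∀ b ∈ B, b ∉ A' := fun b hb h' =>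
            Finset.disjoint_left.1 hdis' h' (hg0.sub hb)
          refine ⟨hg0.card, hg0.pair, hg0.conn, hcol, ?_,
            hg0.sub.trans Finset.subset_union_left, q3, ?_, ?_, ?_, ?_⟩
          · intro a ha b hab hb
            by_cases hbx : b = x
            · subst hbx
              rw [Function.update_self] at hb
              subst hb
              exact absurd (hA'.1.2.2.2 b hxA' a hab.symm (hcol a ha)) (hB' a ha)
            · rw [Function.update_of_ne hbx] at hb
              exact hg0.closed a ha b hab hb
          · rw [Function.update_of_ne q1]; exact hg0.ne
          · rw [Function.update_of_ne q1]
            exact sat_stay G r hd hA hx hij hF.1 hdis hux q1 hg0.mem hg0.sat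
          · intro e h1 h2 h3
            by_cases hex : e = x
            · subst hex
              rw [Function.update_self] at h2
              subst h2
              exact ⟨Or.inl rfl, hA'.2.1 e hxA'⟩
            · rw [Function.update_of_ne hex] at h2
              obtain ⟨p1, p2⟩ := hg0.ext e h1 h2 h3
              refine ⟨(hold e p1).2.2, ?_⟩
              have := sat_stay G r hd hA hx hij hF.1 hdis hux hex p1 (by rw [h2]; exact p2)
              rwa [h2] at this
          · have key : ∀ e, G.Adj x0 e → φ e = i0 → e ∉ B → e ≠ x → j = i0 → ¬ G.Adj x e := by
              intro e h1 h2 h3 h4 h5 h6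
              obtain ⟨p1, p2⟩ := hg0.ext e h1 h2 h3
              exact (hold e p1).2.1 (hA'.1.2.2.2 x hxA' e h6
                (by rw [Function.update_of_ne h4, h2, h5]))
            intro e h1 h2 h3 e' h1' h2' h3' hadj
            by_cases hex : e = x
            · have hex' : e' ≠ x := fun h => hadj.ne (hex.trans h.symm)
              rw [hex, Function.update_self] at h2
              rw [Function.update_of_ne hex'] at h2'
              exact key e' h1' h2' h3' hex' h2 (hex ▸ hadj)
            · rw [Function.update_of_ne hex] at h2
              by_cases hex' : e' = x
              · rw [hex', Function.update_self] at h2'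
                exact key e h1 h2 h3 hex h2' (hex' ▸ hadj.symm)
              · rw [Function.update_of_ne hex'] at h2'
                exact hg0.ind e h1 h2 h3 e' h1' h2' h3' hadj
      · intro v hv
        rcases Finset.mem_union.1 hv with h | h
        · obtain ⟨g, hg, hvg⟩ := hU v h
          exact ⟨g, Set.mem_insert_of_mem _ hg, hvg⟩
        · exact ⟨_, Set.mem_insert _ _, h⟩
      · have : U.card < (U ∪ A.erase x).card := by
          apply Finset.card_lt_card
          rw [Finset.ssubset_iff_of_subset Finset.subset_union_left]
          exact ⟨u, by simp [hu, hxu.symm], Finset.disjoint_left.1 hdis hu⟩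
        omega
    · rw [Finset.not_disjoint_iff] at hdis'
      obtain ⟨v, hvA', hvU⟩ := hdis'
      obtain ⟨⟨x0, i0, B⟩, hg, hvB⟩ := hU v hvU
      have hg0 := hGh _ hg
      have hcol := hcolB _ hg
      dsimp only at hg0 hcol hvB
      have : i0 = j := (hcol v hvB).symm.trans (hA'.1.2.1 v hvA')
      subst this
      exact final_contra G r hd hA hx hij hF hdis hux hxu hA' hg0
        (hA'.1.subset_of hg0.conn hcol hvA' hvB)

lemma no_obs (hd : ∀ v, G.degree v + 2 ≤ ∑ i, r i + k) {φ : V → Fin k} (hφ : CMin G r φ)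
    (i : Fin k) (A : Finset V) : ¬ Obs G r φ i A := by
  intro hA
  obtain ⟨u, hu⟩ := hA.1.1
  exact walk G r hd (Fintype.card V + 1) φ i A ∅ u ∅ hφ hA hu (by simp) (by simp) (by simp)
    (by simp)

end PNRC

/-- If `r₁ + ⋯ + r_k ≥ Δ(G) + 2 - k`, then the vertex set of `G` can be partitioned into
sets `V₁, …, V_k` such that `Δ(G[Vᵢ]) ≤ rᵢ` and `G[Vᵢ]` contains no connected component
that is `rᵢ`-regular and not complete. -/
theorem partition_no_noncomplete_regular_components {V : Type*} [Fintype V]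
    (G : SimpleGraph V) (k : ℕ) (r : Fin k → ℕ)
    (hsum : G.maxDegree + 2 ≤ ∑ i, r i + k) :
    ∃ P : Fin k → Finset V,
      (∀ i j, i ≠ j → Disjoint (P i) (P j)) ∧
      (∀ v : V, ∃ i, v ∈ P i) ∧
      ∀ i : Fin k,
        (G.induce (↑(P i) : Set V)).maxDegree ≤ r i ∧
        ∀ D : (G.induce (↑(P i) : Set V)).ConnectedComponent,
          ¬ ((∀ v ∈ D.supp, (G.induce (↑(P i) : Set V)).degree v = r i) ∧
              ∃ u ∈ D.supp, ∃ w ∈ D.supp,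
                u ≠ w ∧ ¬ (G.induce (↑(P i) : Set V)).Adj u w) := by
  have hd : ∀ v, G.degree v + 2 ≤ ∑ i, r i + k := by
    intro v
    have := G.degree_le_maxDegree v
    omega
  have hk : 0 < k := by
    rcases Nat.eq_zero_or_pos k with h | h
    · subst h
      simp at hsum
    · exact h
  haveI : Nonempty (V → Fin k) := ⟨fun _ => ⟨0, hk⟩⟩
  obtain ⟨φ, hφ⟩ := PNRC.exists_CMin G r
  refine ⟨fun i => Finset.univ.filter (fun v => φ v = i), ?_, ?_, ?_⟩
  · intro i j hij
    rw [Finset.disjoint_left]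
    intro v hv hv'
    simp only [Finset.mem_filter, Finset.mem_univ, true_and] at hv hv'
    exact hij (hv.symm.trans hv')
  · intro v
    exact ⟨φ v, by simp⟩
  · intro i
    dsimp only
    set S : Finset V := Finset.univ.filter (fun v => φ v = i) with hS
    have hmem : ∀ v, v ∈ (↑S : Set V) ↔ φ v = i := by intro v; simp [hS]
    have hdeg : ∀ v : (↑S : Set V), (G.induce (↑S : Set V)).degree v = PNRC.dg G φ i v.1 := by
      intro v
      rw [← SimpleGraph.card_neighborFinset_eq_degree]
      unfold PNRC.dg
      rw [← Finset.card_map (Function.Embedding.subtype (fun x => x ∈ (↑S : Set V)))]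
      congr 1
      ext w
      simp only [Finset.mem_map, SimpleGraph.mem_neighborFinset, SimpleGraph.comap_adj,
        Finset.mem_filter, Finset.mem_univ, true_and]
      constructor
      · rintro ⟨a, ha, rfl⟩
        exact ⟨ha, (hmem a.1).1 a.2⟩
      · rintro ⟨h1, h2⟩
        exact ⟨⟨w, (hmem w).2 h2⟩, h1, rfl⟩
    constructor
    · apply SimpleGraph.maxDegree_le_of_forall_degree_le
      intro v
      rw [hdeg v]
      have h1 := PNRC.dg_le G r hd hφ.1 v.1
      rw [(hmem v.1).1 v.2] at h1
      exact h1
    · rintro D ⟨hreg, u, hu, w, hw, huw, hnadj⟩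
      let A : Finset V := Finset.univ.filter
        (fun v => ∃ h : v ∈ (↑S : Set V), (⟨v, h⟩ : (↑S : Set V)) ∈ D.supp)
      have hA : ∀ v : (↑S : Set V), v.1 ∈ A ↔ v ∈ D.supp := by
        intro v
        simp only [A, Finset.mem_filter, Finset.mem_univ, true_and]
        exact ⟨fun ⟨_, h⟩ => h, fun h => ⟨v.2, h⟩⟩
      have hAS : ∀ v ∈ A, v ∈ (↑S : Set V) := by
        intro v hv
        simp only [A, Finset.mem_filter, Finset.mem_univ, true_and] at hv
        exact hv.1
      refine PNRC.no_obs G r hd hφ i A ⟨⟨⟨u.1, (hA u).2 hu⟩, ?_, ?_, ?_⟩, ?_, ?_⟩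
      · intro v hv
        exact (hmem v).1 (hAS v hv)
      · intro T hT hne hcl
        apply Finset.Subset.antisymm hT
        obtain ⟨t, ht⟩ := hne
        have htS := hAS t (hT ht)
        have htD := (hA ⟨t, htS⟩).1 (hT ht)
        have hwalk : ∀ (a b : (↑S : Set V)) (p : (G.induce (↑S : Set V)).Walk a b),
            a.1 ∈ T → b.1 ∈ T := by
          intro a b p
          induction p with
          | nil => exact id
          | cons h p ih =>
            intro ha
            apply ih
            refine hcl _ ha _ ?_ h
            rw [hA]
            have h1 := (hA _).1 (hT ha)
            rw [SimpleGraph.ConnectedComponent.mem_supp_iff] at h1 ⊢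
            rw [← h1]
            exact SimpleGraph.ConnectedComponent.sound h.symm.reachable
        intro b hb
        have hbD := (hA ⟨b, hAS b hb⟩).1 hb
        rw [SimpleGraph.ConnectedComponent.mem_supp_iff] at hbD htD
        obtain ⟨p⟩ := SimpleGraph.ConnectedComponent.exact (htD.trans hbD.symm)
        exact hwalk _ _ p ht
      · intro a ha b hab hb
        have haS := hAS a ha
        have hbS := (hmem b).2 hb
        have haD := (hA ⟨a, haS⟩).1 ha
        refine (hA ⟨b, hbS⟩).2 ?_
        rw [SimpleGraph.ConnectedComponent.mem_supp_iff] at haD ⊢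
        rw [← haD]
        apply SimpleGraph.ConnectedComponent.sound
        apply SimpleGraph.Adj.reachable
        exact hab.symm
      · intro v hv
        have h1 := hreg ⟨v, hAS v hv⟩ ((hA _).1 hv)
        rw [hdeg] at h1
        exact h1
      · exact ⟨u.1, (hA u).2 hu, w.1, (hA w).2 hw, fun h => huw (Subtype.ext h), hnadj⟩
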